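/- arXiv:1208.5235 — 4 statements merged into one kernel-verified Lean document; each statement's English description precedes it below -/
import Mathlib

section
/- For every real x with |x| ≤ 3π/2, cos(x) ≤ exp(−x²/(2π²)). -/
/-- For every real `x` with `|x| ≤ 3π/2`, `cos x ≤ exp(−x²/(2π²))`. -/
theorem cos_le_exp_neg_sq (x : ℝ) (hx : |x| ≤ 3 * Real.pi / 2) :
    Real.cos x ≤ Real.exp (-x ^ 2 / (2 * Real.pi ^ 2)) := by
  have hpi := Real.pi_pos
  rcases le_total |x| Real.pi with h | h
  · have h_quadratic : 1 - 2 / Real.pi ^ 2 * x ^ 2 ≤ -x ^ 2 / (2 * Real.pi ^ 2) + 1 := by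
      have h_diff : -x ^ 2 / (2 * Real.pi ^ 2) + 1 - (1 - 2 / Real.pi ^ 2 * x ^ 2)
          = 3 / 2 * (x ^ 2 / Real.pi ^ 2) := by
        field_simp
        ring
      have : 0 ≤ x ^ 2 / Real.pi ^ 2 := by positivity
      linarith
    exact (Real.cos_le_one_sub_mul_cos_sq h).trans (h_quadratic.trans (Real.add_one_le_exp _))
  · rw [← Real.cos_abs x]
    exact (Real.cos_nonpos_of_pi_div_two_le_of_le (by linarith) (by linarith)).trans
      (Real.exp_pos _).le
end

section
/- Let n ≥ 1, let a₁, …, a_r ∈ ℤ/nℤ, and for k ∈ ℤ/nℤ let λ_k = (1/(2r+1))·(1 + 2·Σ_{i=1}^{r} cos(2π·k·a_i/n)) be the eigenvalues of the type r walk. Then for every k, λ_k ≤ exp( −(8/(2r+1)²) · Σ_{i=1}^{r} ⟨k·a_i/n⟩² ), where ⟨x⟩ ∈ (−1/2, 1/2] denotes the representative of x modulo 1 of smallest absolute value. -/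
/-- `⟨x⟩`: the unique representative of `x` modulo 1 lying in `(−1/2, 1/2]`. -/
noncomputable def nearestRep (x : ℝ) : ℝ := 1 / 2 - Int.fract (1 / 2 - x)

/-- The eigenvalue `λ_k = (1/(2r+1))·(1 + 2·∑_{i} cos(2π·k·a_i/n))` of the type `r` walk. -/
noncomputable def walkEig (n r : ℕ) (a : Fin r → ZMod n) (k : ZMod n) : ℝ :=
  (1 / (2 * (r : ℝ) + 1)) *
    (1 + 2 * ∑ i : Fin r, Real.cos (2 * Real.pi * ((k * a i).val : ℝ) / n))

theorem cos_two_pi_mul_nearestRep (x : ℝ) :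
    Real.cos (2 * Real.pi * nearestRep x) = Real.cos (2 * Real.pi * x) := by
  have h : 2 * Real.pi * nearestRep x =
      2 * Real.pi * x + (⌊1 / 2 - x⌋ : ℤ) * (2 * Real.pi) := by
    rw [nearestRep, Int.fract]
    ring
  rw [h, Real.cos_add_int_mul_two_pi]

theorem abs_nearestRep_le (x : ℝ) : |nearestRep x| ≤ 1 / 2 := by
  have h₀ := Int.fract_nonneg (1 / 2 - x)
  have h₁ := Int.fract_lt_one (1 / 2 - x)
  rw [nearestRep, abs_le]
  constructor <;> linarith

theorem cos_two_pi_mul_le (x : ℝ) :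
    Real.cos (2 * Real.pi * x) ≤ 1 - 8 * nearestRep x ^ 2 := by
  have hpi := Real.pi_pos
  have hx : |2 * Real.pi * nearestRep x| ≤ Real.pi := by
    rw [abs_mul, abs_of_pos (by positivity)]
    nlinarith [abs_nearestRep_le x]
  rw [← cos_two_pi_mul_nearestRep]
  refine (Real.cos_le_one_sub_mul_cos_sq hx).trans_eq ?_
  field_simp
  ring

/-- Upper bound for the eigenvalues of a type `r` walk:
`λ_k ≤ exp(−(8/(2r+1)²)·∑_i ⟨k·a_i/n⟩²)`. -/
theorem walkEig_le_exp (n r : ℕ) [NeZero n] (a : Fin r → ZMod n) (k : ZMod n) :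
    walkEig n r a k ≤
      Real.exp (-(8 / (2 * (r : ℝ) + 1) ^ 2) *
        ∑ i : Fin r, nearestRep (((k * a i).val : ℝ) / n) ^ 2) := by
  set S := ∑ i : Fin r, nearestRep (((k * a i).val : ℝ) / n) ^ 2 with hS
  have hS₀ : 0 ≤ S := Finset.sum_nonneg fun i _ => sq_nonneg _
  have hcos : ∑ i : Fin r, Real.cos (2 * Real.pi * ((k * a i).val : ℝ) / n) ≤ r - 8 * S := by
    calc
      _ ≤ ∑ i : Fin r, (1 - 8 * nearestRep (((k * a i).val : ℝ) / n) ^ 2) :=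
        Finset.sum_le_sum fun i _ => by
          rw [mul_div_assoc]
          exact cos_two_pi_mul_le _
      _ = r - 8 * S := by simp [hS, Finset.mul_sum]
  set m : ℝ := 2 * r + 1 with hm
  have hm₁ : 1 ≤ m := by
    rw [hm]
    linarith [Nat.cast_nonneg (α := ℝ) r]
  have hm₀ : 0 < m := by linarith
  have hcoeff : 8 / m ^ 2 ≤ 16 / m := by
    rw [div_le_div_iff₀ (by positivity) hm₀]
    nlinarith
  calc
    walkEig n r a k ≤ 1 / m * (1 + 2 * (r - 8 * S)) := by
      rw [walkEig]
      gcongr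
    _ = -(16 / m * S) + 1 := by
      rw [show 1 + 2 * (r - 8 * S) = m - 16 * S by rw [hm]; ring]
      field_simp
      ring
    _ ≤ -(8 / m ^ 2) * S + 1 := by
      linarith [mul_le_mul_of_nonneg_right hcoeff hS₀]
    _ ≤ Real.exp (-(8 / m ^ 2) * S) := Real.add_one_le_exp _
end

section
/- Let n ≥ 1, let a₁, …, a_r ∈ ℤ/nℤ, and let λ_k = (1/(2r+1))·(1 + 2·Σ_{i=1}^{r} cos(2π·k·a_i/n)). If k ∈ ℤ/nℤ satisfies |⟨k·a_i/n⟩| ≤ 1/(2π) for all i, then λ_k ≥ exp( −(8π²/(2r+1)) · Σ_{i=1}^{r} ⟨k·a_i/n⟩² ). -/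
theorem nearestRep_eq_add_floor (x : ℝ) : nearestRep x = x + (⌊1 / 2 - x⌋ : ℤ) := by
  unfold nearestRep
  rw [Int.fract]
  ring

theorem exp_neg_two_mul_le_one_sub {y : ℝ} (h0 : 0 ≤ y) (h1 : y ≤ 1 / 2) :
    Real.exp (-(2 * y)) ≤ 1 - y := by
  rw [Real.exp_neg, inv_le_iff_one_le_mul₀ (Real.exp_pos _)]
  calc (1 : ℝ) ≤ (1 - y) * (2 * y + 1) := by nlinarith
    _ ≤ (1 - y) * Real.exp (2 * y) :=
      mul_le_mul_of_nonneg_left (Real.add_one_le_exp _) (by linarith)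

/-- Lower bound for the eigenvalues of a type `r` walk: if `|⟨k·a_i/n⟩| ≤ 1/(2π)` for all `i`,
then `λ_k ≥ exp(−(8π²/(2r+1))·∑_i ⟨k·a_i/n⟩²)`. -/
theorem walkEig_ge_exp (n r : ℕ) [NeZero n] (a : Fin r → ZMod n) (k : ZMod n)
    (hk : ∀ i : Fin r, |nearestRep (((k * a i).val : ℝ) / n)| ≤ 1 / (2 * Real.pi)) :
    Real.exp (-(8 * Real.pi ^ 2 / (2 * (r : ℝ) + 1)) *
        ∑ i : Fin r, nearestRep (((k * a i).val : ℝ) / n) ^ 2) ≤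
      walkEig n r a k := by
  set x : Fin r → ℝ := fun i => nearestRep (((k * a i).val : ℝ) / n)
  set s : ℝ := ∑ i, (2 * Real.pi * x i) ^ 2 with hs
  have hr : (0 : ℝ) < 2 * r + 1 := by positivity
  have hs0 : 0 ≤ s := Finset.sum_nonneg fun i _ => sq_nonneg _
  have hsr : s ≤ r := by
    calc s ≤ ∑ _i : Fin r, (1 : ℝ) := by
          refine Finset.sum_le_sum fun i _ => ?_
          rw [sq_le_one_iff_abs_le_one, abs_mul, abs_of_pos Real.two_pi_pos, mul_comm]
          exact (le_div_iff₀ Real.two_pi_pos).mp (hk i)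
      _ = r := by simp
  have hcos : (r : ℝ) - s / 2 ≤
      ∑ i : Fin r, Real.cos (2 * Real.pi * ((k * a i).val : ℝ) / n) := by
    calc (r : ℝ) - s / 2 = ∑ i, (1 - (2 * Real.pi * x i) ^ 2 / 2) := by
          simp [hs, Finset.sum_div]
      _ ≤ _ := by
          refine Finset.sum_le_sum fun i _ => ?_
          rw [mul_div_assoc, ← cos_two_pi_mul_nearestRep]
          exact Real.one_sub_sq_div_two_le_cos
  have hexp : -(8 * Real.pi ^ 2 / (2 * (r : ℝ) + 1)) * ∑ i, x i ^ 2 =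
      -(2 * (s / (2 * r + 1))) := by
    simp only [hs, mul_pow, ← Finset.mul_sum]
    ring
  calc _ = Real.exp (-(2 * (s / (2 * r + 1)))) := congrArg Real.exp hexp
    _ ≤ 1 - s / (2 * r + 1) := by
        refine exp_neg_two_mul_le_one_sub (by positivity) ?_
        rw [div_le_iff₀ hr]
        linarith
    _ = 1 / (2 * r + 1) * (1 + 2 * (r - s / 2)) := by
        field_simp
        ring
    _ ≤ walkEig n r a k := by
        unfold walkEig
        gcongr
end

section
/- Let v₁, …, v_d be vectors in ℝ^r with ‖v_i‖₂ ≥ 1 for all i and ⟨v_i, v_j⟩ ≥ 0 for all i ≠ j (an acute family). Then for every real a > 0, Σ_{ω ∈ (ℤ_{>0})^d} exp(−a·‖ω₁ v₁ + … + ω_d v_d‖₂²) ≤ (e^a − 1)^{−d}, where the sum is over all d-tuples of positive integers. -/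
open RealInnerProductSpace

/-- The geometric series `∑_{n ≥ 1} e^{-an}` sums to `(e^a - 1)⁻¹`. -/
theorem hasSum_exp_neg_mul_pnat {a : ℝ} (ha : 0 < a) :
    HasSum (fun n : ℕ+ => Real.exp (-a * n)) (Real.exp a - 1)⁻¹ := by
  have hlt : Real.exp (-a) < 1 := by simpa using ha
  have hgeom := (hasSum_geometric_of_lt_one (Real.exp_pos (-a)).le hlt).mul_left (Real.exp (-a))
  have hval : Real.exp (-a) * (1 - Real.exp (-a))⁻¹ = (Real.exp a - 1)⁻¹ := by
    have h1 : 1 < Real.exp a := Real.one_lt_exp_iff.mpr ha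
    have h2 : Real.exp a - 1 ≠ 0 := by linarith
    have h3 : 1 - Real.exp (-a) ≠ 0 := by linarith
    rw [Real.exp_neg] at h3 ⊢
    field_simp
  rw [hval] at hgeom
  rw [← Equiv.pnatEquivNat.symm.hasSum_iff]
  have hterm : (fun n : ℕ+ => Real.exp (-a * n)) ∘ Equiv.pnatEquivNat.symm =
      fun n : ℕ => Real.exp (-a) * Real.exp (-a) ^ n := by
    funext n
    simp only [Function.comp_apply, Equiv.pnatEquivNat_symm_apply, Nat.succPNat_coe]
    rw [← Real.exp_nat_mul, ← Real.exp_add]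
    push_cast
    ring_nf
  rw [hterm]
  exact hgeom

/-- A combination with coefficients at least `1` of an acute family of vectors of norm at
least `1` has squared norm at least the sum of the coefficients. -/
theorem sum_le_norm_sum_smul_sq {ι E : Type*} [Fintype ι] [NormedAddCommGroup E]
    [InnerProductSpace ℝ E] {v : ι → E} (hnorm : ∀ i, 1 ≤ ‖v i‖)
    (hacute : ∀ i j, i ≠ j → 0 ≤ ⟪v i, v j⟫) {c : ι → ℝ} (hc : ∀ i, 1 ≤ c i) :
    ∑ i, c i ≤ ‖∑ i, c i • v i‖ ^ 2 := by
  have hc0 : ∀ i, 0 ≤ c i := fun i => zero_le_one.trans (hc i)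
  rw [← real_inner_self_eq_norm_sq, sum_inner]
  refine Finset.sum_le_sum fun i _ => ?_
  rw [inner_sum]
  have hdiag : c i ≤ ⟪c i • v i, c i • v i⟫ := by
    rw [real_inner_self_eq_norm_sq, norm_smul, Real.norm_of_nonneg (hc0 i)]
    have : c i ≤ c i * ‖v i‖ := le_mul_of_one_le_right (hc0 i) (hnorm i)
    nlinarith [hc i]
  refine hdiag.trans (Finset.single_le_sum (f := fun j => ⟪c i • v i, c j • v j⟫)
    (fun j _ => ?_) (Finset.mem_univ i))
  rw [real_inner_smul_left, real_inner_smul_right]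
  rcases eq_or_ne i j with rfl | hij
  · exact mul_nonneg (hc0 i) (mul_nonneg (hc0 i) real_inner_self_nonneg)
  · exact mul_nonneg (hc0 i) (mul_nonneg (hc0 j) (hacute i j hij))

/-- Finite partial sums of a product of nonnegative functions of separate variables are
bounded by the product of the sums. -/
theorem sum_prod_le_pow_of_hasSum {ι α : Type*} [Fintype ι] {f : α → ℝ} {s : ℝ}
    (hf : ∀ x, 0 ≤ f x) (hs : HasSum f s) (u : Finset (ι → α)) :
    ∑ ω ∈ u, ∏ i, f (ω i) ≤ s ^ Fintype.card ι := by
  classical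
  let t : ι → Finset α := fun i => u.image fun ω => ω i
  calc ∑ ω ∈ u, ∏ i, f (ω i)
      ≤ ∑ ω ∈ Fintype.piFinset t, ∏ i, f (ω i) :=
        Finset.sum_le_sum_of_subset_of_nonneg
          (fun ω hω => Fintype.mem_piFinset.mpr fun _ => Finset.mem_image_of_mem _ hω)
          fun ω _ _ => Finset.prod_nonneg fun i _ => hf (ω i)
    _ = ∏ i, ∑ x ∈ t i, f x := (Finset.prod_univ_sum t fun _ => f).symm
    _ ≤ ∏ _i : ι, s :=
        Finset.prod_le_prod (fun i _ => Finset.sum_nonneg fun x _ => hf x)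
          fun i _ => sum_le_hasSum (t i) (fun x _ => hf x) hs
    _ = s ^ Fintype.card ι := by simp

/-- Let `v₁, …, v_d ∈ ℝ^r` with `‖v_i‖ ≥ 1` and `⟪v_i, v_j⟫ ≥ 0` for `i ≠ j` (an acute
family). Then for every `a > 0`,
`∑_{ω ∈ (ℤ_{>0})^d} exp(−a·‖ω₁v₁ + … + ω_d v_d‖²) ≤ (e^a − 1)^{−d}`. -/
theorem tsum_exp_acute_family_le (r d : ℕ) (v : Fin d → EuclideanSpace ℝ (Fin r))
    (hnorm : ∀ i, 1 ≤ ‖v i‖) (hacute : ∀ i j, i ≠ j → 0 ≤ ⟪v i, v j⟫)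
    (a : ℝ) (ha : 0 < a) :
    ∑' ω : Fin d → ℕ+, Real.exp (-a * ‖∑ i : Fin d, (ω i : ℝ) • v i‖ ^ 2) ≤
      ((Real.exp a - 1) ^ d)⁻¹ := by
  refine Real.tsum_le_of_sum_le (fun ω => (Real.exp_pos _).le) fun u => ?_
  have hbound := sum_prod_le_pow_of_hasSum (fun n : ℕ+ => (Real.exp_pos (-a * n)).le)
    (hasSum_exp_neg_mul_pnat ha) u
  rw [Fintype.card_fin, inv_pow] at hbound
  refine (Finset.sum_le_sum fun ω _ => ?_).trans hbound
  rw [← Real.exp_sum, ← Finset.mul_sum, Real.exp_le_exp]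
  exact mul_le_mul_of_nonpos_left
    (sum_le_norm_sum_smul_sq hnorm hacute fun i => by exact_mod_cast (ω i).pos)
    (by linarith)
end
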